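/- arXiv:1201.4285 — 8 statements merged into one kernel-verified Lean document; each statement's English description precedes it below -/
import Mathlib

section
/- Let X be a finite set partitioned into nonempty blocks S₁, …, Sₙ, let p and r be strictly positive probability mass functions on X, and let q ≠ 1. Set mᵢ = ∑_{x∈Sᵢ} p(x), sᵢ = ∑_{x∈Sᵢ} r(x), and let pᵢ(x) = p(x)/mᵢ and rᵢ(x) = r(x)/sᵢ denote the conditional distributions on Sᵢ. Then I_q(p‖r) = ∑ᵢ mᵢ I_q(pᵢ‖rᵢ) − ∑ᵢ mᵢ ln_q(sᵢ/mᵢ) + (1−q) ∑ᵢ mᵢ ln_q(sᵢ/mᵢ) I_q(pᵢ‖rᵢ). -/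
/-- The q-logarithm: `ln_q x = (x^(1-q) - 1)/(1-q)`. -/
noncomputable def qlog (q x : ℝ) : ℝ := (x ^ (1 - q) - 1) / (1 - q)

/-- The Tsallis divergence restricted to a finite subset `S`:
`I_q(p‖r) = -∑_{x ∈ S} p x * ln_q (r x / p x)`. -/
noncomputable def tsallisDivOn {X : Type*} (q : ℝ) (S : Finset X) (p r : X → ℝ) : ℝ :=
  - ∑ x ∈ S, p x * qlog q (r x / p x)

/-- The pseudo-additivity of the `q`-logarithm. -/
theorem qlog_mul {q x y : ℝ} (hq : q ≠ 1) (hx : 0 ≤ x) (hy : 0 ≤ y) :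
    qlog q (x * y) = qlog q x + qlog q y + (1 - q) * (qlog q x * qlog q y) := by
  have h : 1 - q ≠ 0 := sub_ne_zero.mpr hq.symm
  unfold qlog
  rw [Real.mul_rpow hx hy]
  field_simp
  ring

/-- The divergence on a single block in terms of its masses and conditional distributions. -/
theorem tsallisDivOn_eq_conditional {X : Type*} {q : ℝ} (hq : q ≠ 1) {S : Finset X}
    (hS : S.Nonempty) {p r : X → ℝ} (hp : ∀ x ∈ S, 0 < p x) (hr : ∀ x ∈ S, 0 < r x) :
    tsallisDivOn q S p r =
      (∑ x ∈ S, p x) *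
        tsallisDivOn q S (fun x => p x / ∑ y ∈ S, p y) (fun x => r x / ∑ y ∈ S, r y)
      - (∑ x ∈ S, p x) * qlog q ((∑ x ∈ S, r x) / (∑ x ∈ S, p x))
      + (1 - q) * ((∑ x ∈ S, p x) * qlog q ((∑ x ∈ S, r x) / (∑ x ∈ S, p x)) *
          tsallisDivOn q S (fun x => p x / ∑ y ∈ S, p y) (fun x => r x / ∑ y ∈ S, r y)) := by
  have hm : 0 < ∑ x ∈ S, p x := Finset.sum_pos hp hS
  have hs : 0 < ∑ x ∈ S, r x := Finset.sum_pos hr hS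
  unfold tsallisDivOn
  set m := ∑ x ∈ S, p x with hm_def
  set s := ∑ x ∈ S, r x
  have key : ∀ x ∈ S, p x * qlog q (r x / p x) =
      p x * qlog q (s / m) + m * (1 + (1 - q) * qlog q (s / m)) *
        (p x / m * qlog q (r x / s / (p x / m))) := by
    intro x hx
    have hpx := hp x hx
    have hrx := hr x hx
    have hfactor : r x / p x = s / m * (r x / s / (p x / m)) := by field_simp
    rw [hfactor, qlog_mul hq (by positivity) (by positivity)]
    field_simp
    ring
  rw [Finset.sum_congr rfl key, Finset.sum_add_distrib, ← Finset.sum_mul, ← Finset.mul_sum,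
    ← hm_def]
  ring

/-- Decomposition of the Tsallis divergence along a partition of the state space. -/
theorem tsallisDiv_partition {X : Type*} [Fintype X] {n : ℕ} (S : Fin n → Finset X)
    (hne : ∀ i, (S i).Nonempty)
    (hdisj : ∀ i j, i ≠ j → Disjoint (S i) (S j))
    (hcover : ∀ x : X, ∃ i, x ∈ S i)
    (q : ℝ) (hq : q ≠ 1)
    (p r : X → ℝ) (hp : ∀ x, 0 < p x) (hpsum : ∑ x, p x = 1)
    (hr : ∀ x, 0 < r x) (hrsum : ∑ x, r x = 1) :
    tsallisDivOn q Finset.univ p r =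
      (∑ i, (∑ x ∈ S i, p x) *
        tsallisDivOn q (S i) (fun x => p x / ∑ y ∈ S i, p y) (fun x => r x / ∑ y ∈ S i, r y))
      - (∑ i, (∑ x ∈ S i, p x) * qlog q ((∑ x ∈ S i, r x) / (∑ x ∈ S i, p x)))
      + (1 - q) * ∑ i, (∑ x ∈ S i, p x) * qlog q ((∑ x ∈ S i, r x) / (∑ x ∈ S i, p x)) *
          tsallisDivOn q (S i) (fun x => p x / ∑ y ∈ S i, p y) (fun x => r x / ∑ y ∈ S i, r y) := by
  classical
  have hunion : (Finset.univ : Finset X) = Finset.univ.biUnion S := by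
    ext x
    simpa using hcover x
  have hsplit : tsallisDivOn q Finset.univ p r = ∑ i, tsallisDivOn q (S i) p r := by
    unfold tsallisDivOn
    rw [hunion, Finset.sum_biUnion fun i _ j _ hij => hdisj i j hij, Finset.sum_neg_distrib]
  rw [hsplit, Finset.sum_congr rfl fun i _ =>
    tsallisDivOn_eq_conditional hq (hne i) (fun x _ => hp x) (fun x _ => hr x),
    Finset.sum_add_distrib, Finset.sum_sub_distrib, ← Finset.mul_sum]
end

section
/- (Uniqueness) Let q > 0 with q ≠ 1, let X be a finite set, let r be a strictly positive probability mass function on X, and let C be a convex set of strictly positive probability mass functions on X. If p₁ ∈ C and p₂ ∈ C both attain the minimum of I_q(·‖r) over C, then p₁ = p₂. -/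
/-- The Tsallis divergence `I_q(p‖r) = -∑_x p x * ln_q (r x / p x)`. -/
noncomputable def tsallisDiv {X : Type*} [Fintype X] (q : ℝ) (p r : X → ℝ) : ℝ :=
  - ∑ x, p x * qlog q (r x / p x)

theorem mul_qlog_div {q r t : ℝ} (hr : 0 < r) (ht : 0 < t) :
    t * qlog q (r / t) = (r ^ (1 - q) * t ^ q - t) / (1 - q) := by
  have h : t * (r / t) ^ (1 - q) = r ^ (1 - q) * t ^ q := by
    rw [Real.div_rpow hr.le ht.le, Real.rpow_sub ht, Real.rpow_one]
    have := (Real.rpow_pos_of_pos ht q).ne'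
    field_simp
  rw [qlog, ← h]
  ring

theorem strictConvexOn_rpow_div_sub_one {q : ℝ} (hq0 : 0 < q) (hq1 : q ≠ 1) :
    StrictConvexOn ℝ (Set.Ioi 0) fun t : ℝ => t ^ q / (q - 1) := by
  refine ⟨convex_Ioi 0, fun x hx y hy hxy a b ha hb hab => ?_⟩
  simp only [smul_eq_mul]
  have hx0 : x ∈ Set.Ici (0 : ℝ) := Set.Ioi_subset_Ici_self hx
  have hy0 : y ∈ Set.Ici (0 : ℝ) := Set.Ioi_subset_Ici_self hy
  have hsum : a * (x ^ q / (q - 1)) + b * (y ^ q / (q - 1)) =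
      (a * x ^ q + b * y ^ q) / (q - 1) := by ring
  rw [hsum]
  rcases hq1.lt_or_gt with h | h
  · exact div_lt_div_of_neg_of_lt (sub_neg.2 h)
      ((Real.strictConcaveOn_rpow hq0 h).2 hx0 hy0 hxy ha hb hab)
  · exact div_lt_div_of_pos_right ((strictConvexOn_rpow h).2 hx0 hy0 hxy ha hb hab) (sub_pos.2 h)

theorem strictConvexOn_neg_mul_qlog_div {q r : ℝ} (hq0 : 0 < q) (hq1 : q ≠ 1) (hr : 0 < r) :
    StrictConvexOn ℝ (Set.Ioi 0) fun t : ℝ => -(t * qlog q (r / t)) := by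
  refine ⟨convex_Ioi 0, fun x hx y hy hxy a b ha hb hab => ?_⟩
  have hz := convex_Ioi (0 : ℝ) hx hy ha.le hb.le hab
  have key := mul_lt_mul_of_pos_left
    ((strictConvexOn_rpow_div_sub_one hq0 hq1).2 hx hy hxy ha hb hab)
    (Real.rpow_pos_of_pos hr (1 - q))
  simp only [smul_eq_mul] at hz key ⊢
  have hform : ∀ t : ℝ, 0 < t → -(t * qlog q (r / t)) =
      r ^ (1 - q) * (t ^ q / (q - 1)) - t / (q - 1) := fun t ht => by
    rw [mul_qlog_div hr ht, ← neg_sub q 1, div_neg]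
    ring
  rw [hform _ hz, hform _ hx, hform _ hy]
  linear_combination key

/-- The Tsallis divergence is strictly convex in its first argument. -/
theorem strictConvexOn_tsallisDiv {X : Type*} [Fintype X] {q : ℝ} (hq0 : 0 < q) (hq1 : q ≠ 1)
    {r : X → ℝ} (hr : ∀ x, 0 < r x) :
    StrictConvexOn ℝ {p : X → ℝ | ∀ x, 0 < p x} fun p => tsallisDiv q p r := by
  refine ⟨fun p hp s hs a b ha hb hab x => convex_Ioi (0 : ℝ) (hp x) (hs x) ha hb hab,
    fun p hp s hs hps a b ha hb hab => ?_⟩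
  obtain ⟨x₀, hx₀⟩ := Function.ne_iff.1 hps
  simp only [tsallisDiv, smul_eq_mul, ← Finset.sum_neg_distrib, Finset.mul_sum,
    ← Finset.sum_add_distrib]
  refine Finset.sum_lt_sum (fun x _ => ?_) ⟨x₀, Finset.mem_univ _, ?_⟩
  · exact (strictConvexOn_neg_mul_qlog_div hq0 hq1 (hr x)).convexOn.2 (hp x) (hs x) ha.le hb.le hab
  · exact (strictConvexOn_neg_mul_qlog_div hq0 hq1 (hr x₀)).2 (hp x₀) (hs x₀) hx₀ ha hb hab

/-- Uniqueness: the minimizer of the Tsallis divergence over a convex set of strictly positive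
pmfs is unique. -/
theorem tsallisDiv_min_unique {X : Type*} [Fintype X] (q : ℝ) (hq0 : 0 < q) (hq1 : q ≠ 1)
    (r : X → ℝ) (hr : ∀ x, 0 < r x) (hrsum : ∑ x, r x = 1)
    (C : Set (X → ℝ))
    (hCpmf : ∀ p ∈ C, (∀ x, 0 < p x) ∧ (∑ x, p x = 1))
    (hCconv : ∀ p₁ ∈ C, ∀ p₂ ∈ C, ∀ l : ℝ, 0 ≤ l → l ≤ 1 →
      (fun x => l * p₁ x + (1 - l) * p₂ x) ∈ C)
    (p₁ : X → ℝ) (hp₁ : p₁ ∈ C) (hp₁min : ∀ s ∈ C, tsallisDiv q p₁ r ≤ tsallisDiv q s r)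
    (p₂ : X → ℝ) (hp₂ : p₂ ∈ C) (hp₂min : ∀ s ∈ C, tsallisDiv q p₂ r ≤ tsallisDiv q s r) :
    p₁ = p₂ := by
  have hconv : Convex ℝ C := fun p hp s hs a b ha _ hab => by
    obtain rfl : b = 1 - a := by linarith
    exact hCconv p hp s hs a ha (by linarith)
  exact ((strictConvexOn_tsallisDiv hq0 hq1 hr).subset (fun p hp => (hCpmf p hp).1) hconv)
    |>.eq_of_isMinOn hp₁min hp₂min hp₁ hp₂
end

section
/- Let q > 0 with q ≠ 1, let X be a finite set, and let p and r be strictly positive probability mass functions on X. Then I_q(p‖r) ≥ 0, and I_q(p‖r) = 0 if and only if p = r. -/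
/-- The q-logarithm lies strictly below its tangent line at `1`. -/
theorem qlog_lt_sub_one {q x : ℝ} (hq0 : 0 < q) (hq1 : q ≠ 1) (hx : 0 < x) (hx1 : x ≠ 1) :
    qlog q x < x - 1 := by
  unfold qlog
  rcases lt_or_gt_of_ne hq1 with h | h
  · have hb := rpow_one_add_lt_one_add_mul_self (s := x - 1) (by linarith) (sub_ne_zero.mpr hx1)
      (sub_pos.mpr h) (by linarith)
    rw [add_sub_cancel] at hb
    rw [div_lt_iff₀ (by linarith)]
    linarith
  · have hlog := Real.log_lt_sub_one_of_pos hx hx1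
    have hexp := Real.add_one_le_exp (Real.log x * (1 - q))
    rw [← Real.rpow_def_of_pos hx] at hexp
    have hmul := mul_lt_mul_of_neg_right hlog (sub_neg.mpr h)
    rw [div_lt_iff_of_neg (by linarith)]
    linarith

theorem qlog_one (q : ℝ) : qlog q 1 = 0 := by simp [qlog]

theorem mul_qlog_div_lt_sub {q a b : ℝ} (hq0 : 0 < q) (hq1 : q ≠ 1) (ha : 0 < a) (hb : 0 < b)
    (hab : a ≠ b) : a * qlog q (b / a) < b - a := by
  have hne : b / a ≠ 1 := fun h => hab ((div_eq_one_iff_eq ha.ne').mp h).symm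
  calc a * qlog q (b / a) < a * (b / a - 1) :=
        mul_lt_mul_of_pos_left (qlog_lt_sub_one hq0 hq1 (div_pos hb ha) hne) ha
    _ = b - a := by field_simp

theorem mul_qlog_div_le_sub {q a b : ℝ} (hq0 : 0 < q) (hq1 : q ≠ 1) (ha : 0 < a) (hb : 0 < b) :
    a * qlog q (b / a) ≤ b - a := by
  rcases eq_or_ne a b with rfl | hab
  · simp [div_self ha.ne', qlog_one]
  · exact (mul_qlog_div_lt_sub hq0 hq1 ha hb hab).le

/-- Nonnegativity of the Tsallis divergence, with equality iff the distributions agree. -/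
theorem tsallisDiv_nonneg_and_eq_zero_iff {X : Type*} [Fintype X] (q : ℝ) (hq0 : 0 < q)
    (hq1 : q ≠ 1) (p r : X → ℝ) (hp : ∀ x, 0 < p x) (hpsum : ∑ x, p x = 1)
    (hr : ∀ x, 0 < r x) (hrsum : ∑ x, r x = 1) :
    0 ≤ tsallisDiv q p r ∧ (tsallisDiv q p r = 0 ↔ p = r) := by
  have hle (x : X) : p x * qlog q (r x / p x) ≤ r x - p x :=
    mul_qlog_div_le_sub hq0 hq1 (hp x) (hr x)
  have hsum : ∑ x, (r x - p x) = 0 := by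
    rw [Finset.sum_sub_distrib, hpsum, hrsum, sub_self]
  refine ⟨?_, fun h => ?_, ?_⟩
  · exact neg_nonneg.mpr ((Finset.sum_le_sum fun x _ => hle x).trans hsum.le)
  · have heq : ∑ x, p x * qlog q (r x / p x) = ∑ x, (r x - p x) :=
      (neg_eq_zero.mp h).trans hsum.symm
    funext x
    by_contra hx
    exact (mul_qlog_div_lt_sub hq0 hq1 (hp x) (hr x) hx).ne
      ((Finset.sum_eq_sum_iff_of_le fun y _ => hle y).mp heq x (Finset.mem_univ x))
  · rintro rfl
    simp [tsallisDiv, div_self (hp _).ne', qlog_one]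
end

section
/- (Invariance under redundant information) Let q > 0 with q ≠ 1, let X be a finite set, let r be a strictly positive probability mass function on X, and let C₁ and C₂ be sets of strictly positive probability mass functions on X. Suppose p attains the minimum of I_q(·‖r) over C₁ and p ∈ C₂. Then p attains the minimum of I_q(·‖r) over C₁ ∩ C₂, p attains the minimum of I_q(·‖p) over C₁ ∩ C₂, and p attains the minimum of I_q(·‖p) over C₂. -/
/-- The tangent-line bound at `1` for the `q`-logarithm. -/
theorem qlog_le_sub_one {q x : ℝ} (hq0 : 0 < q) (hq1 : q ≠ 1) (hx : 0 < x) :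
    qlog q x ≤ x - 1 := by
  unfold qlog
  rcases hq1.lt_or_gt with h | h
  · rw [div_le_iff₀ (by linarith)]
    have := rpow_one_add_le_one_add_mul_self (s := x - 1) (p := 1 - q)
      (by linarith) (by linarith) (by linarith)
    rw [add_sub_cancel] at this
    linarith
  · rw [div_le_iff_of_neg (by linarith), Real.rpow_def_of_pos hx]
    have h₁ := Real.add_one_le_exp (Real.log x * (1 - q))
    have h₂ := mul_le_mul_of_nonpos_right (Real.log_le_sub_one_of_pos hx)
      (by linarith : 1 - q ≤ 0)
    linarith

/-- The Tsallis divergence is nonnegative. -/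
theorem tsallisDiv_nonneg {X : Type*} [Fintype X] {q : ℝ} (hq0 : 0 < q) (hq1 : q ≠ 1)
    {p r : X → ℝ} (hp : ∀ x, 0 < p x) (hr : ∀ x, 0 < r x) (hpr : ∑ x, p x = ∑ x, r x) :
    0 ≤ tsallisDiv q p r := by
  have h : ∑ x, p x * qlog q (r x / p x) ≤ ∑ x, (r x - p x) := by
    refine Finset.sum_le_sum fun x _ => ?_
    calc p x * qlog q (r x / p x) ≤ p x * (r x / p x - 1) :=
          mul_le_mul_of_nonneg_left (qlog_le_sub_one hq0 hq1 (div_pos (hr x) (hp x))) (hp x).le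
      _ = r x - p x := by rw [mul_sub, mul_div_cancel₀ _ (hp x).ne', mul_one]
  rw [Finset.sum_sub_distrib, hpr, sub_self] at h
  exact neg_nonneg.mpr h

theorem tsallisDiv_self {X : Type*} [Fintype X] (q : ℝ) {p : X → ℝ} (hp : ∀ x, p x ≠ 0) :
    tsallisDiv q p p = 0 := by
  simp [tsallisDiv, qlog, hp]

/-- Invariance under redundant information. -/
theorem tsallisDiv_invariance_redundant {X : Type*} [Fintype X] (q : ℝ) (hq0 : 0 < q)
    (hq1 : q ≠ 1)
    (r : X → ℝ) (hr : ∀ x, 0 < r x) (hrsum : ∑ x, r x = 1)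
    (C₁ C₂ : Set (X → ℝ))
    (hC₁pmf : ∀ s ∈ C₁, (∀ x, 0 < s x) ∧ (∑ x, s x = 1))
    (hC₂pmf : ∀ s ∈ C₂, (∀ x, 0 < s x) ∧ (∑ x, s x = 1))
    (p : X → ℝ) (hp₁ : p ∈ C₁) (hp₂ : p ∈ C₂)
    (hmin : ∀ s ∈ C₁, tsallisDiv q p r ≤ tsallisDiv q s r) :
    (∀ u ∈ C₁ ∩ C₂, tsallisDiv q p r ≤ tsallisDiv q u r) ∧
    (∀ u ∈ C₁ ∩ C₂, tsallisDiv q p p ≤ tsallisDiv q u p) ∧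
    (∀ u ∈ C₂, tsallisDiv q p p ≤ tsallisDiv q u p) := by
  obtain ⟨hp, hpsum⟩ := hC₂pmf p hp₂
  have h : ∀ u ∈ C₂, tsallisDiv q p p ≤ tsallisDiv q u p := fun u hu => by
    obtain ⟨hu_pos, husum⟩ := hC₂pmf u hu
    rw [tsallisDiv_self q fun x => (hp x).ne']
    exact tsallisDiv_nonneg hq0 hq1 hu_pos hp (husum.trans hpsum.symm)
  exact ⟨fun u hu => hmin u hu.1, fun u hu => h u hu.2, h⟩
end

section
/- Let X be a finite set partitioned into nonempty blocks S₁, …, Sₙ, let q ≠ 1, and let p and r be strictly positive probability mass functions on X with block masses uᵢ = ∑_{x∈Sᵢ} p(x) and sᵢ = ∑_{x∈Sᵢ} r(x). If the conditional distributions agree on every block, i.e. p(x)/uᵢ = r(x)/sᵢ for all x ∈ Sᵢ and all i, then I_q(p‖r) = −∑ᵢ uᵢ ln_q(sᵢ/uᵢ); that is, the Tsallis divergence of p from r equals the Tsallis divergence of the aggregated distribution (u₁,…,uₙ) from the aggregated distribution (s₁,…,sₙ). -/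
/-- A sum over a finite type splits along the blocks of a partition. -/
theorem sum_univ_eq_sum_blocks {X ι M : Type*} [Fintype X] [Fintype ι] [AddCommMonoid M]
    (S : ι → Finset X) (hdisj : ∀ i j, i ≠ j → Disjoint (S i) (S j))
    (hcover : ∀ x : X, ∃ i, x ∈ S i) (f : X → M) :
    ∑ x, f x = ∑ i, ∑ x ∈ S i, f x := by
  classical
  rw [← Finset.sum_biUnion fun i _ j _ hij => hdisj i j hij]
  congr 1
  ext x
  simpa using hcover x

/-- If the conditional distributions of p and r agree on every block of a partition, then the
Tsallis divergence of p from r equals that of the aggregated (block-mass) distributions. -/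
theorem tsallisDiv_aggregation {X : Type*} [Fintype X] {n : ℕ} (S : Fin n → Finset X)
    (hne : ∀ i, (S i).Nonempty)
    (hdisj : ∀ i j, i ≠ j → Disjoint (S i) (S j))
    (hcover : ∀ x : X, ∃ i, x ∈ S i)
    (q : ℝ) (hq : q ≠ 1)
    (p r : X → ℝ) (hp : ∀ x, 0 < p x) (hpsum : ∑ x, p x = 1)
    (hr : ∀ x, 0 < r x) (hrsum : ∑ x, r x = 1)
    (hcond : ∀ i, ∀ x ∈ S i, p x / (∑ y ∈ S i, p y) = r x / (∑ y ∈ S i, r y)) :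
    tsallisDivOn q Finset.univ p r =
      - ∑ i, (∑ x ∈ S i, p x) * qlog q ((∑ x ∈ S i, r x) / (∑ x ∈ S i, p x)) := by
  rw [tsallisDivOn, sum_univ_eq_sum_blocks S hdisj hcover]
  congr 1
  refine Finset.sum_congr rfl fun i _ => ?_
  rw [Finset.sum_mul]
  refine Finset.sum_congr rfl fun x hx => ?_
  have hu : 0 < ∑ y ∈ S i, p y := Finset.sum_pos (fun y _ => hp y) (hne i)
  have hs : 0 < ∑ y ∈ S i, r y := Finset.sum_pos (fun y _ => hr y) (hne i)
  have hratio : r x / p x = (∑ y ∈ S i, r y) / ∑ y ∈ S i, p y := by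
    have h := hcond i x hx
    rw [div_eq_div_iff hu.ne' hs.ne'] at h
    rw [div_eq_div_iff (hp x).ne' hu.ne']
    linarith
  rw [hratio]
end

section
/- Let X be a finite set and let p and r be strictly positive probability mass functions on X. Then the Tsallis divergence recovers the Kullback–Leibler divergence in the limit q → 1: lim_{q→1} I_q(p‖r) = ∑_{x∈X} p(x) log(p(x)/r(x)), where the limit is taken over q ≠ 1. -/
/-- The q-logarithm tends to the natural logarithm as `q → 1`. -/
theorem tendsto_qlog_log {x : ℝ} (hx : 0 < x) :
    Filter.Tendsto (fun q => qlog q x) (nhdsWithin 1 {(1 : ℝ)}ᶜ) (nhds (Real.log x)) := by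
  have hderiv : HasDerivAt (fun q : ℝ => x ^ (1 - q)) (-Real.log x) 1 := by
    simpa using ((hasDerivAt_id (1 : ℝ)).const_sub 1).const_rpow hx
  have hslope := hderiv.tendsto_slope.neg
  rw [neg_neg] at hslope
  refine hslope.congr fun q => ?_
  rw [slope_def_field, qlog, sub_self, Real.rpow_zero, ← div_neg, neg_sub]

/-- The Tsallis divergence recovers the Kullback–Leibler divergence in the limit q → 1. -/
theorem tsallisDiv_tendsto_kl {X : Type*} [Fintype X]
    (p r : X → ℝ) (hp : ∀ x, 0 < p x) (hpsum : ∑ x, p x = 1)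
    (hr : ∀ x, 0 < r x) (hrsum : ∑ x, r x = 1) :
    Filter.Tendsto (fun q => tsallisDiv q p r) (nhdsWithin 1 {(1 : ℝ)}ᶜ)
      (nhds (∑ x, p x * Real.log (p x / r x))) := by
  have hlog : ∑ x, p x * Real.log (p x / r x) = -∑ x, p x * Real.log (r x / p x) := by
    rw [← Finset.sum_neg_distrib]
    refine Finset.sum_congr rfl fun x _ => ?_
    rw [← inv_div, Real.log_inv, mul_neg]
  rw [hlog]
  exact (tendsto_finsetSum _ fun x _ =>
    (tendsto_qlog_log (div_pos (hr x) (hp x))).const_mul (p x)).neg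
end

section
/- (Joint convexity) Let q > 0 with q ≠ 1 and let X be a finite set. For strictly positive probability mass functions p₁, p₂, r₁, r₂ on X and λ ∈ [0,1], one has I_q(λp₁ + (1−λ)p₂ ‖ λr₁ + (1−λ)r₂) ≤ λ I_q(p₁‖r₁) + (1−λ) I_q(p₂‖r₂); in particular I_q is a convex function of each of its two arguments separately. -/
theorem convexOn_rpow_of_nonpos {s : ℝ} (hs : s ≤ 0) :
    ConvexOn ℝ (Set.Ioi 0) fun x : ℝ => x ^ s := by
  have hlog : ConvexOn ℝ (Set.Ioi 0) fun x => -s * -Real.log x :=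
    strictConcaveOn_log_Ioi.concaveOn.neg.smul (neg_nonneg.2 hs)
  refine ⟨convex_Ioi 0, fun x hx y hy a b ha hb hab => ?_⟩
  have hz : 0 < a • x + b • y := convex_Ioi (0 : ℝ) hx hy ha hb hab
  have hexp : ∀ {z : ℝ}, 0 < z → z ^ s = Real.exp (-s * -Real.log z) := fun hz => by
    rw [Real.rpow_def_of_pos hz, neg_mul_neg, mul_comm]
  simp only [hexp hz, hexp hx, hexp hy]
  exact (Real.exp_le_exp.2 (hlog.2 hx hy ha hb hab)).trans
    (convexOn_exp.2 (Set.mem_univ _) (Set.mem_univ _) ha hb hab)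

theorem concaveOn_qlog {q : ℝ} (hq0 : 0 < q) (hq1 : q ≠ 1) :
    ConcaveOn ℝ (Set.Ioi 0) (qlog q) := by
  rcases lt_or_gt_of_ne hq1 with h | h
  · have hc : ConcaveOn ℝ (Set.Ioi (0 : ℝ)) fun x : ℝ => x ^ (1 - q) :=
      (Real.concaveOn_rpow (by linarith) (by linarith)).subset Set.Ioi_subset_Ici_self
        (convex_Ioi 0)
    have hs := (hc.add_const (-1)).smul (c := (1 - q)⁻¹) (by rw [inv_nonneg]; linarith)
    refine hs.congr fun x _ => ?_
    simp [qlog, div_eq_inv_mul, sub_eq_add_neg]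
  · have hc : ConvexOn ℝ (Set.Ioi (0 : ℝ)) fun x : ℝ => x ^ (1 - q) :=
      convexOn_rpow_of_nonpos (by linarith)
    have hs := ((hc.add_const (-1)).smul (c := (q - 1)⁻¹) (by rw [inv_nonneg]; linarith)).neg
    refine hs.congr fun x _ => ?_
    have h₁ : q - 1 ≠ 0 := by linarith
    have h₂ : 1 - q ≠ 0 := by linarith
    simp only [qlog, Pi.neg_apply, Pi.add_apply, smul_eq_mul]
    grind

/-- The perspective `(p, r) ↦ p * f (r / p)` of a concave function `f` is jointly concave. -/
theorem ConcaveOn.perspective_le {f : ℝ → ℝ} (hf : ConcaveOn ℝ (Set.Ioi 0) f)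
    {p₁ p₂ r₁ r₂ a b : ℝ} (hp₁ : 0 < p₁) (hp₂ : 0 < p₂) (hr₁ : 0 < r₁) (hr₂ : 0 < r₂)
    (ha : 0 ≤ a) (hb : 0 ≤ b) (hab : 0 < a + b) :
    a * (p₁ * f (r₁ / p₁)) + b * (p₂ * f (r₂ / p₂)) ≤
      (a * p₁ + b * p₂) * f ((a * r₁ + b * r₂) / (a * p₁ + b * p₂)) := by
  have hP : 0 < a * p₁ + b * p₂ := by
    rcases ha.eq_or_lt with rfl | ha'
    · have : 0 < b := by linarith
      positivity
    · positivity
  have h := hf.2 (Set.mem_Ioi.2 (div_pos hr₁ hp₁)) (Set.mem_Ioi.2 (div_pos hr₂ hp₂))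
    (show 0 ≤ a * p₁ / (a * p₁ + b * p₂) by positivity)
    (show 0 ≤ b * p₂ / (a * p₁ + b * p₂) by positivity) (by field_simp)
  have harg : a * p₁ / (a * p₁ + b * p₂) * (r₁ / p₁) + b * p₂ / (a * p₁ + b * p₂) * (r₂ / p₂) =
      (a * r₁ + b * r₂) / (a * p₁ + b * p₂) := by
    field_simp
  simp only [smul_eq_mul, harg] at h
  calc _ = (a * p₁ + b * p₂) * (a * p₁ / (a * p₁ + b * p₂) * f (r₁ / p₁) +
        b * p₂ / (a * p₁ + b * p₂) * f (r₂ / p₂)) := by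
        field_simp
    _ ≤ _ := by gcongr

/-- Joint convexity of the Tsallis divergence in the pair of its arguments. -/
theorem tsallisDiv_jointly_convex {X : Type*} [Fintype X] (q : ℝ) (hq0 : 0 < q) (hq1 : q ≠ 1)
    (p₁ p₂ r₁ r₂ : X → ℝ)
    (hp₁ : ∀ x, 0 < p₁ x) (hp₁sum : ∑ x, p₁ x = 1)
    (hp₂ : ∀ x, 0 < p₂ x) (hp₂sum : ∑ x, p₂ x = 1)
    (hr₁ : ∀ x, 0 < r₁ x) (hr₁sum : ∑ x, r₁ x = 1)
    (hr₂ : ∀ x, 0 < r₂ x) (hr₂sum : ∑ x, r₂ x = 1)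
    (l : ℝ) (hl0 : 0 ≤ l) (hl1 : l ≤ 1) :
    tsallisDiv q (fun x => l * p₁ x + (1 - l) * p₂ x) (fun x => l * r₁ x + (1 - l) * r₂ x) ≤
      l * tsallisDiv q p₁ r₁ + (1 - l) * tsallisDiv q p₂ r₂ := by
  have hsum : l * ∑ x, p₁ x * qlog q (r₁ x / p₁ x) + (1 - l) * ∑ x, p₂ x * qlog q (r₂ x / p₂ x) ≤
      ∑ x, (l * p₁ x + (1 - l) * p₂ x) *
        qlog q ((l * r₁ x + (1 - l) * r₂ x) / (l * p₁ x + (1 - l) * p₂ x)) := by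
    rw [Finset.mul_sum, Finset.mul_sum, ← Finset.sum_add_distrib]
    exact Finset.sum_le_sum fun x _ => (concaveOn_qlog hq0 hq1).perspective_le
      (hp₁ x) (hp₂ x) (hr₁ x) (hr₂ x) hl0 (by linarith) (by linarith)
  simp only [tsallisDiv]
  linarith
end

section
/- Let q > 0 with q ≠ 1, let X be a finite set, let r be a strictly positive probability mass function on X, let u₁, …, u_M : X → ℝ, and let λ, β₁, …, β_M ∈ ℝ. Suppose p is a strictly positive probability mass function on X satisfying the stationarity condition ln_q(r(x)/p(x)) = λ − ∑_{m=1}^M β_m u_m(x) for every x ∈ X. Then p minimizes the Tsallis divergence subject to the moment constraints: for every strictly positive probability mass function l on X with ∑_{x∈X} l(x) u_m(x) = ∑_{x∈X} p(x) u_m(x) for all m = 1, …, M, one has I_q(p‖r) ≤ I_q(l‖r). -/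
/-- Bernoulli's inequality, divided by `1 - q` so that it covers both `q < 1` and `1 < q`. -/
theorem bernoulli_div_one_sub_nonneg {q t : ℝ} (hq0 : 0 < q) (hq1 : q ≠ 1) (ht : 0 < t) :
    0 ≤ (1 + q * (t - 1) - t ^ q) / (1 - q) := by
  have hs : -1 ≤ t - 1 := by linarith
  have hts : 1 + (t - 1) = t := by ring
  rcases lt_or_gt_of_ne hq1 with h | h
  · have hB := rpow_one_add_le_one_add_mul_self hs hq0.le h.le
    rw [hts] at hB
    exact div_nonneg (by linarith) (by linarith)
  · have hB := one_add_mul_self_le_rpow_one_add hs h.le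
    rw [hts] at hB
    exact div_nonneg_of_nonpos (by linarith) (by linarith)

/-- Tangent line inequality for the convex function `t ↦ -t * ln_q (r / t)` at `p`. -/
theorem qlog_tangent_le {q r p l : ℝ} (hq0 : 0 < q) (hq1 : q ≠ 1)
    (hr : 0 < r) (hp : 0 < p) (hl : 0 < l) :
    (l - p) * (1 - q * qlog q (r / p)) ≤ p * qlog q (r / p) - l * qlog q (r / l) := by
  have hq : 1 - q ≠ 0 := sub_ne_zero.mpr hq1.symm
  have ht : 0 < l / p := div_pos hl hp
  have key : l * (r / l) ^ (1 - q) = p * (r / p) ^ (1 - q) * (l / p) ^ q := by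
    have hrl : r / l = (r / p) / (l / p) := by field_simp
    rw [hrl, Real.div_rpow (div_pos hr hp).le ht.le, Real.rpow_sub ht, Real.rpow_one]
    have := Real.rpow_pos_of_pos ht q
    field_simp
  have hB := mul_nonneg (mul_pos hp (Real.rpow_pos_of_pos (div_pos hr hp) (1 - q))).le
    (bernoulli_div_one_sub_nonneg hq0 hq1 ht)
  have expand : p * qlog q (r / p) - l * qlog q (r / l) - (l - p) * (1 - q * qlog q (r / p)) =
      p * (r / p) ^ (1 - q) * ((1 + q * (l / p - 1) - (l / p) ^ q) / (1 - q)) := by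
    have hl_qlog : l * qlog q (r / l) =
        (p * (r / p) ^ (1 - q) * (l / p) ^ q - l) / (1 - q) := by
      rw [← key, qlog]
      ring
    rw [hl_qlog, qlog]
    generalize (r / p) ^ (1 - q) = a
    generalize (l / p) ^ q = b
    field_simp
    ring
  linarith

/-- A distribution satisfying the stationarity condition minimizes the Tsallis divergence
subject to the corresponding moment constraints. -/
theorem tsallisDiv_stationary_min {X : Type*} [Fintype X] (q : ℝ) (hq0 : 0 < q) (hq1 : q ≠ 1)
    (r : X → ℝ) (hr : ∀ x, 0 < r x) (hrsum : ∑ x, r x = 1)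
    {M : ℕ} (u : Fin M → X → ℝ) (lam : ℝ) (β : Fin M → ℝ)
    (p : X → ℝ) (hp : ∀ x, 0 < p x) (hpsum : ∑ x, p x = 1)
    (hstat : ∀ x, qlog q (r x / p x) = lam - ∑ m, β m * u m x) :
    ∀ l : X → ℝ, (∀ x, 0 < l x) → (∑ x, l x = 1) →
      (∀ m, ∑ x, l x * u m x = ∑ x, p x * u m x) →
      tsallisDiv q p r ≤ tsallisDiv q l r := by
  intro l hl hlsum hmom
  have hexp : ∀ f : X → ℝ, ∑ x, f x = 1 → ∑ x, f x * qlog q (r x / p x) =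
      lam - ∑ m, β m * ∑ x, f x * u m x := by
    intro f hf
    simp_rw [hstat, mul_sub, Finset.sum_sub_distrib, ← Finset.sum_mul, hf, one_mul,
      Finset.mul_sum]
    rw [Finset.sum_comm]
    simp_rw [mul_left_comm]
  have heq : ∑ x, l x * qlog q (r x / p x) = ∑ x, p x * qlog q (r x / p x) := by
    rw [hexp l hlsum, hexp p hpsum]
    simp_rw [hmom]
  have hzero : ∑ x, (l x - p x) * (1 - q * qlog q (r x / p x)) = 0 := by
    have hsplit : ∀ x, (l x - p x) * (1 - q * qlog q (r x / p x)) =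
        l x - p x - q * (l x * qlog q (r x / p x) - p x * qlog q (r x / p x)) := by
      intro x
      ring
    simp_rw [hsplit, Finset.sum_sub_distrib, ← Finset.mul_sum, Finset.sum_sub_distrib,
      heq, hlsum, hpsum]
    ring
  have hsum := Finset.sum_le_sum fun x (_ : x ∈ Finset.univ) =>
    qlog_tangent_le hq0 hq1 (hr x) (hp x) (hl x)
  rw [hzero, Finset.sum_sub_distrib] at hsum
  unfold tsallisDiv
  linarith
end
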